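/- arXiv:2212.06983 — 2 statements merged into one kernel-verified Lean document; each statement's English description precedes it below -/
import Mathlib

section
/- (The quadratic transform for MSRP is a special case of SCQP.) Fix w^k ∈ W with x^k = x(w^k) > r_f and set y^k = y(w^k) > 0. Then the quadratic-transform subproblem objective −(2(x^k − r_f)/y^k)(x(w) − r_f) + ((x^k − r_f)/y^k)² y(w) equals the SCQP surrogate objective −λ_x x(w) + λ_y y(w), with λ_x = 1/√(y^k) and λ_y = (x^k − r_f)/(2 (y^k)^{3/2}) (the negative partial derivative in x and the partial derivative in y of F_SR(x, y) = −(x − r_f)/√y at (x^k, y^k)), multiplied by the positive factor 2(x^k − r_f)/√(y^k) and shifted by an additive constant; hence the two problems have the same set of minimizers over W. -/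
/- STATEMENT 14: The quadratic transform for MSRP is a special case of SCQP. The QT
subproblem objective equals the SCQP surrogate −λ_x x(w) + λ_y y(w), with
λ_x = 1/√(y^k) = −∂F_SR/∂x(x^k,y^k) and λ_y = (x^k−r_f)/(2 (y^k)^{3/2}) = ∂F_SR/∂y(x^k,y^k),
multiplied by the positive factor 2(x^k−r_f)/√(y^k) and shifted by a constant; hence the
two problems have the same minimizers over W. -/

noncomputable section
open Matrix

def simplex (N : ℕ) : Set (Fin N → ℝ) := {w | (∀ i, 0 ≤ w i) ∧ ∑ i, w i = 1}

def xf {N : ℕ} (μ : Fin N → ℝ) (w : Fin N → ℝ) : ℝ := w ⬝ᵥ μ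

def yf {N : ℕ} (S : Matrix (Fin N) (Fin N) ℝ) (w : Fin N → ℝ) : ℝ := w ⬝ᵥ S.mulVec w

theorem quadratic_transform_msrp_special_case_of_scqp
    (N : ℕ) (μ : Fin N → ℝ) (S : Matrix (Fin N) (Fin N) ℝ) (hS : S.PosDef)
    (rf : ℝ)
    (wk : Fin N → ℝ) (hwk : wk ∈ simplex N)
    (xk yk : ℝ) (hxk : xk = xf μ wk) (hyk : yk = yf S wk)
    (hxkrf : rf < xk) (hykpos : 0 < yk) :
    -- λ_x = 1/√(y^k) is minus the partial derivative in x of F_SR(x,y) = −(x−r_f)/√y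
    HasDerivAt (fun t : ℝ => -((t - rf) / Real.sqrt yk)) (-(1 / Real.sqrt yk)) xk ∧
    -- λ_y = (x^k−r_f)/(2 (y^k)^{3/2}) is the partial derivative in y of F_SR at (x^k,y^k)
    HasDerivAt (fun s : ℝ => -((xk - rf) / Real.sqrt s))
      ((xk - rf) / (2 * (yk * Real.sqrt yk))) yk ∧
    -- the positive factor
    (0 < 2 * (xk - rf) / Real.sqrt yk) ∧
    -- the QT subproblem objective is the SCQP surrogate objective scaled by that
    -- factor and shifted by an additive constant
    (∃ cst : ℝ, ∀ w : Fin N → ℝ,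
      -(2 * (xk - rf) / yk) * (xf μ w - rf) + ((xk - rf) / yk) ^ 2 * yf S w =
        (2 * (xk - rf) / Real.sqrt yk) *
          (-((1 / Real.sqrt yk) * xf μ w)
            + ((xk - rf) / (2 * (yk * Real.sqrt yk))) * yf S w) + cst) ∧
    -- hence the two problems have the same set of minimizers over W
    (∀ wstar ∈ simplex N,
      (∀ w ∈ simplex N,
        -(2 * (xk - rf) / yk) * (xf μ wstar - rf) + ((xk - rf) / yk) ^ 2 * yf S wstar ≤
          -(2 * (xk - rf) / yk) * (xf μ w - rf) + ((xk - rf) / yk) ^ 2 * yf S w) ↔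
      (∀ w ∈ simplex N,
        -((1 / Real.sqrt yk) * xf μ wstar)
            + ((xk - rf) / (2 * (yk * Real.sqrt yk))) * yf S wstar ≤
          -((1 / Real.sqrt yk) * xf μ w)
            + ((xk - rf) / (2 * (yk * Real.sqrt yk))) * yf S w)) := by
  have hs : 0 < Real.sqrt yk := Real.sqrt_pos.mpr hykpos
  have hsq : Real.sqrt yk ^ 2 = yk := Real.sq_sqrt hykpos.le
  have hfac : 0 < 2 * (xk - rf) / Real.sqrt yk := div_pos (by linarith) hs
  have key : ∀ w : Fin N → ℝ,
      -(2 * (xk - rf) / yk) * (xf μ w - rf) + ((xk - rf) / yk) ^ 2 * yf S w =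
        (2 * (xk - rf) / Real.sqrt yk) *
          (-((1 / Real.sqrt yk) * xf μ w)
            + ((xk - rf) / (2 * (yk * Real.sqrt yk))) * yf S w)
          + 2 * (xk - rf) / yk * rf := by
    intro w
    generalize Real.sqrt yk = s at hs hsq
    subst hsq
    field_simp
    ring
  refine ⟨?_, ?_, hfac, ⟨_, key⟩, fun wstar _ => forall₂_congr fun w _ => ?_⟩
  · exact (((hasDerivAt_id xk).sub_const rf).div_const (Real.sqrt yk)).neg
  · have h := ((Real.hasDerivAt_sqrt hykpos.ne').fun_inv hs.ne').const_mul (-(xk - rf))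
    refine (h.congr_deriv ?_).congr_of_eventuallyEq (.of_forall fun s => ?_)
    · rw [hsq]
      field_simp
    · ring
  · rw [key wstar, key w, add_le_add_iff_right, mul_le_mul_iff_right₀ hfac]
end
end

section
/- (Dinkelbach's algorithm for MGSRP with β = 1 is a special case of SCQP.) Fix w^k ∈ W with x^k = x(w^k) > r_f and set y^k = y(w^k) > 0. Then Dinkelbach's subproblem objective −(x(w) − r_f) + ((x^k − r_f)/y^k) y(w) equals the SCQP surrogate objective −λ_x x(w) + λ_y y(w), with λ_x = 1/y^k and λ_y = (x^k − r_f)/(y^k)² (the negative partial derivative in x and the partial derivative in y of F_GSR(x, y) = −(x − r_f)/y at (x^k, y^k)), multiplied by the positive factor y^k and shifted by an additive constant; hence the two problems have the same set of minimizers over W. -/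
/- STATEMENT 15: Dinkelbach's algorithm for MGSRP with β = 1 is a special case of SCQP.
Dinkelbach's subproblem objective equals the SCQP surrogate −λ_x x(w) + λ_y y(w), with
λ_x = 1/y^k = −∂F_GSR/∂x(x^k,y^k) and λ_y = (x^k−r_f)/(y^k)² = ∂F_GSR/∂y(x^k,y^k),
multiplied by the positive factor y^k and shifted by a constant; hence the two problems
have the same minimizers over W. -/

noncomputable section
open Matrix

theorem dinkelbach_mgsrp_special_case_of_scqp
    (N : ℕ) (μ : Fin N → ℝ) (S : Matrix (Fin N) (Fin N) ℝ) (hS : S.PosDef)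
    (rf : ℝ)
    (wk : Fin N → ℝ) (hwk : wk ∈ simplex N)
    (xk yk : ℝ) (hxk : xk = xf μ wk) (hyk : yk = yf S wk)
    (hxkrf : rf < xk) (hykpos : 0 < yk) :
    -- λ_x = 1/y^k is minus the partial derivative in x of F_GSR(x,y) = −(x−r_f)/y
    HasDerivAt (fun t : ℝ => -((t - rf) / yk)) (-(1 / yk)) xk ∧
    -- λ_y = (x^k−r_f)/(y^k)² is the partial derivative in y of F_GSR at (x^k,y^k)
    HasDerivAt (fun s : ℝ => -((xk - rf) / s)) ((xk - rf) / yk ^ 2) yk ∧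
    -- the positive factor
    (0 < yk) ∧
    -- Dinkelbach's subproblem objective is the SCQP surrogate objective scaled by y^k
    -- and shifted by an additive constant
    (∃ cst : ℝ, ∀ w : Fin N → ℝ,
      -(xf μ w - rf) + (xk - rf) / yk * yf S w =
        yk * (-((1 / yk) * xf μ w) + ((xk - rf) / yk ^ 2) * yf S w) + cst) ∧
    -- hence the two problems have the same set of minimizers over W
    (∀ wstar ∈ simplex N,
      (∀ w ∈ simplex N,
        -(xf μ wstar - rf) + (xk - rf) / yk * yf S wstar ≤
          -(xf μ w - rf) + (xk - rf) / yk * yf S w) ↔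
      (∀ w ∈ simplex N,
        -((1 / yk) * xf μ wstar) + ((xk - rf) / yk ^ 2) * yf S wstar ≤
          -((1 / yk) * xf μ w) + ((xk - rf) / yk ^ 2) * yf S w)) := by
  have hne : yk ≠ 0 := hykpos.ne'
  have objective_eq : ∀ w : Fin N → ℝ,
      -(xf μ w - rf) + (xk - rf) / yk * yf S w =
        yk * (-((1 / yk) * xf μ w) + ((xk - rf) / yk ^ 2) * yf S w) + rf := by
    intro w
    field_simp
    ring
  refine ⟨?_, ?_, hykpos, ⟨rf, objective_eq⟩, ?_⟩
  · exact (((hasDerivAt_id xk).sub_const rf).div_const yk).neg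
  · refine (((hasDerivAt_const yk (xk - rf)).div (hasDerivAt_id yk) hne).neg).congr_deriv ?_
    simp [← neg_div]
  · intro wstar _
    refine forall₂_congr fun w _ => ?_
    rw [objective_eq, objective_eq, add_le_add_iff_right, mul_le_mul_iff_right₀ hykpos]
end
end
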